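/- arXiv:2205.07488 — 2 statements merged into one kernel-verified Lean document; each statement's English description precedes it below -/
import Mathlib

section
/- There exists a function τ : ℝ → ℝ with τ(b) → 1 as b → 0⁺ such that the following holds. For all integers d ≥ 1 and 1 ≤ s ≤ d, all real b ∈ (0, 1/36), letting λ := (b/s)·log(e d / s), letting B := { β ∈ {−1, 0, 1}^d : β has exactly s nonzero coordinates }, and letting β₀ ∈ {0,1}^d be the vector whose first s coordinates are 1 and whose remaining coordinates are 0, one has (1/|B|) · ∑_{β ∈ B} exp( λ · ⟨β, β₀⟩² ) ≤ τ(b). -/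
open Real

/-- Rademacher square-exponential bound by induction. -/
lemma rad_aux {ι : Type*} [DecidableEq ι] (c : ι → ℝ) (S : Finset ι) :
    ∀ a : ℝ, 0 ≤ a → 4 * a * ∑ i ∈ S, c i ^ 2 ≤ 1 →
      ∑ A ∈ S.powerset, Real.exp (a * (∑ i ∈ S, (if i ∈ A then c i else - c i)) ^ 2)
        ≤ 2 ^ S.card * Real.exp (2 * a * ∑ i ∈ S, c i ^ 2) := by
  induction S using Finset.induction_on with
  | empty => intro a _ _; simp
  | insert j S hj ih =>
    intro a ha h
    rw [Finset.sum_insert hj] at h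
    rw [Finset.sum_powerset_insert hj, Finset.card_insert_of_notMem hj, Finset.sum_insert hj]
    set V := ∑ i ∈ S, c i ^ 2 with hV
    have hV0 : 0 ≤ V := Finset.sum_nonneg fun i _ => sq_nonneg _
    have hc0 : 0 ≤ c j ^ 2 := sq_nonneg _
    have ha' : 0 ≤ a + 2 * a ^ 2 * c j ^ 2 := by positivity
    have haV : 0 ≤ a * V := by positivity
    have hac : 0 ≤ a * c j ^ 2 := by positivity
    have h' : 4 * (a + 2 * a ^ 2 * c j ^ 2) * V ≤ 1 := by
      nlinarith [mul_nonneg haV hac]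
    have key := ih _ ha' h'
    rw [← Finset.sum_add_distrib]
    have step : ∀ A ∈ S.powerset,
        Real.exp (a * (∑ i ∈ insert j S, (if i ∈ A then c i else - c i)) ^ 2) +
        Real.exp (a * (∑ i ∈ insert j S, (if i ∈ insert j A then c i else - c i)) ^ 2) ≤
        2 * Real.exp (a * c j ^ 2) *
          Real.exp ((a + 2 * a ^ 2 * c j ^ 2) * (∑ i ∈ S, (if i ∈ A then c i else - c i)) ^ 2) := by
      intro A hA
      have hjA : j ∉ A := fun hh => hj (Finset.mem_powerset.1 hA hh)
      rw [Finset.sum_insert hj, Finset.sum_insert hj]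
      have e2 : ∑ i ∈ S, (if i ∈ insert j A then c i else - c i)
          = ∑ i ∈ S, (if i ∈ A then c i else - c i) := by
        apply Finset.sum_congr rfl
        intro i hi
        have : i ≠ j := fun hh => hj (hh ▸ hi)
        simp [Finset.mem_insert, this]
      rw [e2]
      set u := ∑ i ∈ S, (if i ∈ A then c i else - c i)
      simp only [hjA, if_false, Finset.mem_insert_self, if_true]
      have hcosh := Real.cosh_le_exp_half_sq (2 * a * u * c j)
      rw [Real.cosh_eq] at hcosh
      have e3 : Real.exp (a * (-c j + u) ^ 2) =
          Real.exp (a * c j ^ 2) * Real.exp (a * u ^ 2) * Real.exp (-(2 * a * u * c j)) := by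
        rw [← Real.exp_add, ← Real.exp_add]; congr 1; ring
      have e4 : Real.exp (a * (c j + u) ^ 2) =
          Real.exp (a * c j ^ 2) * Real.exp (a * u ^ 2) * Real.exp (2 * a * u * c j) := by
        rw [← Real.exp_add, ← Real.exp_add]; congr 1; ring
      have e5 : Real.exp ((a + 2 * a ^ 2 * c j ^ 2) * u ^ 2) =
          Real.exp (a * u ^ 2) * Real.exp ((2 * a * u * c j) ^ 2 / 2) := by
        rw [← Real.exp_add]; congr 1; ring
      rw [e3, e4, e5]
      have hp : 0 < Real.exp (a * c j ^ 2) * Real.exp (a * u ^ 2) := by positivity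
      nlinarith [mul_le_mul_of_nonneg_left hcosh hp.le]
    refine (Finset.sum_le_sum step).trans ?_
    rw [← Finset.mul_sum]
    refine (mul_le_mul_of_nonneg_left key (by positivity)).trans ?_
    have e6 : 2 * Real.exp (a * c j ^ 2) *
        (2 ^ S.card * Real.exp (2 * (a + 2 * a ^ 2 * c j ^ 2) * V)) =
        2 ^ (S.card + 1) * Real.exp (a * c j ^ 2 + 2 * (a + 2 * a ^ 2 * c j ^ 2) * V) := by
      rw [Real.exp_add]; ring
    rw [e6]
    refine mul_le_mul_of_nonneg_left (Real.exp_le_exp.2 ?_) (by positivity)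
    have : 4 * a * V ≤ 1 := by nlinarith
    nlinarith [mul_le_mul_of_nonneg_left this hac]

lemma choose_lower : ∀ (s d : ℕ), 1 ≤ s → s ≤ d → ((d : ℝ) / s) ^ s ≤ (d.choose s : ℝ) := by
  intro s
  induction s with
  | zero => intro d h; omega
  | succ s ih =>
    intro d _ hd
    obtain ⟨e, rfl⟩ : ∃ e, d = e + 1 := ⟨d - 1, by omega⟩
    rcases Nat.eq_zero_or_pos s with rfl | hs
    · simp
    have hse : s ≤ e := by omega
    have h1 := ih e hs hse
    have h2 : ((e + 1 : ℕ) : ℝ) * (e.choose s : ℝ) = ((e + 1).choose (s + 1) : ℝ) * ((s + 1 : ℕ) : ℝ) := by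
      exact_mod_cast Nat.add_one_mul_choose_eq e s
    have hs0 : (0 : ℝ) < s := by exact_mod_cast hs
    have hse' : (s : ℝ) ≤ e := by exact_mod_cast hse
    have h3 : (((e + 1 : ℕ) : ℝ) / ((s + 1 : ℕ) : ℝ)) ≤ (e : ℝ) / s := by
      push_cast
      rw [div_le_div_iff₀ (by positivity) hs0]
      nlinarith
    have h4 : ((e + 1).choose (s + 1) : ℝ) =
        (((e + 1 : ℕ) : ℝ) / ((s + 1 : ℕ) : ℝ)) * (e.choose s : ℝ) := by
      have : ((s + 1 : ℕ) : ℝ) ≠ 0 := by positivity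
      field_simp
      linarith
    rw [h4, pow_succ']
    refine mul_le_mul_of_nonneg_left ?_ (by positivity)
    exact (pow_le_pow_left₀ (by positivity) h3 s).trans h1

/-- The sparse sign vectors. -/
def BB (d s : ℕ) : Finset (Fin d → Fin 3) :=
  Finset.univ.filter (fun σ => (Finset.univ.filter (fun i => σ i ≠ 1)).card = s)

lemma mem_BB {d s : ℕ} (σ : Fin d → Fin 3) :
    σ ∈ BB d s ↔ (Finset.univ.filter (fun i => σ i ≠ 1)).card = s := by
  simp [BB]

lemma card_BB (d s : ℕ) : (BB d s).card = d.choose s * 2 ^ s := by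
  have hm : ∀ σ ∈ BB d s, (Finset.univ.filter (fun i => σ i ≠ 1)) ∈
      Finset.powersetCard s (Finset.univ : Finset (Fin d)) := by
    intro σ hσ
    rw [Finset.mem_powersetCard]
    exact ⟨Finset.subset_univ _, (mem_BB σ).1 hσ⟩
  rw [Finset.card_eq_sum_card_fiberwise (s := BB d s)
    (f := fun σ : Fin d → Fin 3 => Finset.univ.filter (fun i => σ i ≠ 1))
    (t := Finset.powersetCard s (Finset.univ : Finset (Fin d))) (fun σ h => hm σ h)]
  have : ∀ T ∈ Finset.powersetCard s (Finset.univ : Finset (Fin d)),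
      ((BB d s).filter (fun σ => Finset.univ.filter (fun i => σ i ≠ 1) = T)).card = 2 ^ s := by
    intro T hT
    rw [Finset.mem_powersetCard] at hT
    have e : (BB d s).filter (fun σ => Finset.univ.filter (fun i => σ i ≠ 1) = T) =
        Fintype.piFinset (fun i => if i ∈ T then ({0, 2} : Finset (Fin 3)) else {1}) := by
      ext σ
      rw [Finset.mem_filter, mem_BB, Fintype.mem_piFinset]
      have key : ∀ k : Fin 3, k ∈ ({0, 2} : Finset (Fin 3)) ↔ k ≠ 1 := by decide
      constructor
      · rintro ⟨_, rfl⟩ i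
        by_cases h : σ i = 1
        · simp [h]
        · have : i ∈ Finset.univ.filter (fun i => σ i ≠ 1) := by simp [h]
          rw [if_pos this, key]; exact h
      · intro h
        have : Finset.univ.filter (fun i => σ i ≠ 1) = T := by
          ext i
          have := h i
          by_cases hi : i ∈ T
          · rw [if_pos hi, key] at this; simp [hi, this]
          · rw [if_neg hi, Finset.mem_singleton] at this; simp [hi, this]
        exact ⟨this ▸ hT.2, this⟩
    rw [e, Fintype.card_piFinset]
    have : ∀ i, (if i ∈ T then ({0, 2} : Finset (Fin 3)) else {1}).card
        = if i ∈ T then 2 else 1 := by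
      intro i; split_ifs <;> rfl
    simp only [this]
    rw [Finset.prod_ite]
    simp [hT.2]
  rw [Finset.sum_congr rfl this]
  simp

lemma card_BB_lower (d s : ℕ) (hs : 1 ≤ s) (hd : s ≤ d) :
    (2 * (d : ℝ) / s) ^ s ≤ ((BB d s).card : ℝ) := by
  rw [card_BB, mul_div_assoc, mul_pow, mul_comm]
  push_cast
  exact mul_le_mul_of_nonneg_right (choose_lower s d hs hd) (by positivity)

/-- First coordinates vector. -/
noncomputable def b0 (d s : ℕ) : Fin d → ℝ := fun i => if (i : ℕ) < s then (1 : ℝ) else 0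

/-- Coordinatewise product. -/
noncomputable def cc (d s : ℕ) (σ : Fin d → Fin 3) : Fin d → ℝ :=
  fun i => (((σ i : ℕ) : ℝ) - 1) * b0 d s i

/-- Overlap size. -/
noncomputable def HH (d s : ℕ) (σ : Fin d → Fin 3) : ℝ := ∑ i, cc d s σ i ^ 2

lemma mgf_H (d s : ℕ) (hs : 1 ≤ s) (hd : s ≤ d) :
    ∑ σ ∈ BB d s, Real.exp (Real.log (Real.exp 1 * d / s) * HH d s σ)
      ≤ ((BB d s).card : ℝ) * Real.exp (3 * s) := by
  set L := Real.log (Real.exp 1 * d / s) with hL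
  have hs0 : (0 : ℝ) < s := by exact_mod_cast hs
  have hd0 : (0 : ℝ) < d := by exact_mod_cast (lt_of_lt_of_le hs hd)
  have hexpL : Real.exp L = Real.exp 1 * d / s := Real.exp_log (by positivity)
  set z : ℝ := s / (2 * d) with hz
  have hz0 : 0 < z := by positivity
  let f : Fin d → Fin 3 → ℝ := fun i k =>
    (if k ≠ 1 then z else 1) * Real.exp (L * ((((k : ℕ) : ℝ) - 1) * b0 d s i) ^ 2)
  have hf : ∀ i k, 0 ≤ f i k := by
    intro i k; simp only [f]; split_ifs <;> positivity
  have h1 : ∀ σ ∈ BB d s, Real.exp (L * HH d s σ) = (z ^ s)⁻¹ * ∏ i, f i (σ i) := by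
    intro σ hσ
    simp only [f]
    rw [Finset.prod_mul_distrib, Finset.prod_ite, ← Real.exp_sum, ← Finset.mul_sum]
    simp only [Finset.prod_const, one_pow, mul_one]
    rw [(mem_BB σ).1 hσ, ← mul_assoc, inv_mul_cancel₀ (by positivity), one_mul]
    rfl
  rw [Finset.sum_congr rfl h1, ← Finset.mul_sum]
  have h2 : ∑ σ ∈ BB d s, ∏ i, f i (σ i) ≤ ∏ i, ∑ k, f i k := by
    rw [Finset.prod_univ_sum, Fintype.piFinset_univ]
    exact Finset.sum_le_sum_of_subset_of_nonneg (Finset.subset_univ _)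
      fun σ _ _ => Finset.prod_nonneg fun i _ => hf i _
  have h3 : ∀ i : Fin d, ∑ k, f i k ≤
      (if (i : ℕ) < s then (1 + Real.exp 1) else 1) * Real.exp (s / d) := by
    intro i
    have hsd : 0 ≤ (s : ℝ) / d := by positivity
    have := Real.add_one_le_exp ((s : ℝ) / d)
    rw [Fin.sum_univ_three]
    by_cases hi : (i : ℕ) < s
    · have : 1 ≤ Real.exp ((s : ℝ) / d) := by linarith
      have e : f i 0 + f i 1 + f i 2 = 1 + Real.exp 1 := by
        simp [f, b0, hi]
        norm_num
        rw [hexpL, hz]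
        field_simp
        ring
      rw [e, if_pos hi]
      exact le_mul_of_one_le_right (by positivity) this
    · have e : f i 0 + f i 1 + f i 2 = 1 + s / d := by
        simp [f, b0, hi]
        rw [hz]
        field_simp
        ring
      rw [e, if_neg hi]; linarith
  have h4 : ∏ i, ∑ k, f i k ≤ Real.exp (3 * s) := by
    refine (Finset.prod_le_prod (fun i _ => Finset.sum_nonneg fun k _ => hf i k)
      (fun i _ => h3 i)).trans ?_
    rw [Finset.prod_mul_distrib, Finset.prod_ite]
    have hcard : (Finset.univ.filter (fun i : Fin d => (i : ℕ) < s)).card = s := by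
      rw [Fin.card_filter_val_lt]; omega
    simp only [Finset.prod_const, one_pow, mul_one, Finset.card_univ, Fintype.card_fin]
    rw [hcard, ← Real.exp_nat_mul]
    have e1 : (d : ℝ) * (s / d) = s := by field_simp
    rw [e1]
    have e2 : 1 + Real.exp 1 ≤ Real.exp 2 := by
      have : Real.exp 2 = Real.exp 1 * Real.exp 1 := by rw [← Real.exp_add]; norm_num
      have := Real.add_one_le_exp (1 : ℝ)
      nlinarith
    have e3 : (1 + Real.exp 1) ^ s ≤ Real.exp 2 ^ s := pow_le_pow_left₀ (by positivity) e2 s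
    have e4 : Real.exp (3 * s) = Real.exp 2 ^ s * Real.exp s := by
      rw [← Real.exp_nat_mul, ← Real.exp_add]; congr 1; ring
    rw [e4]
    exact mul_le_mul_of_nonneg_right e3 (by positivity)
  have h5 : (z ^ s)⁻¹ ≤ ((BB d s).card : ℝ) := by
    have : (z ^ s)⁻¹ = (2 * (d : ℝ) / s) ^ s := by
      rw [← inv_pow, hz, inv_div]
    rw [this]; exact card_BB_lower d s hs hd
  exact mul_le_mul h5 (h2.trans h4)
    (Finset.sum_nonneg fun σ _ => Finset.prod_nonneg fun i _ => hf i _)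
    (by positivity)

/-- Sign flip outside of `A`. -/
def flip3 {d : ℕ} (A : Finset (Fin d)) (σ : Fin d → Fin 3) : Fin d → Fin 3 :=
  fun i => if i ∈ A then σ i else Fin.rev (σ i)

lemma flip3_flip3 {d : ℕ} (A : Finset (Fin d)) (σ : Fin d → Fin 3) :
    flip3 A (flip3 A σ) = σ := by
  funext i
  by_cases h : i ∈ A <;> simp [flip3, h]

lemma flip3_mem {d s : ℕ} (A : Finset (Fin d)) (σ : Fin d → Fin 3) (h : σ ∈ BB d s) :
    flip3 A σ ∈ BB d s := by
  rw [mem_BB] at h ⊢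
  rw [← h]
  congr 1
  ext i
  have key : ∀ k : Fin 3, Fin.rev k = 1 ↔ k = 1 := by decide
  rw [Finset.mem_filter, Finset.mem_filter]
  by_cases h : i ∈ A <;> simp [flip3, h, key]

lemma cc_flip3 {d s : ℕ} (A : Finset (Fin d)) (σ : Fin d → Fin 3) (i : Fin d) :
    cc d s (flip3 A σ) i = if i ∈ A then cc d s σ i else - cc d s σ i := by
  have key : ∀ k : Fin 3, (((Fin.rev k : Fin 3) : ℕ) : ℝ) - 1 = -(((k : ℕ) : ℝ) - 1) := by
    intro k; fin_cases k <;> norm_num [Fin.rev]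
  by_cases h : i ∈ A
  · simp [cc, flip3, h]
  · simp only [cc, flip3, h, if_false, key]; ring

lemma abs_cc {d s : ℕ} (σ : Fin d → Fin 3) (i : Fin d) : |cc d s σ i| = cc d s σ i ^ 2 := by
  unfold cc b0
  generalize σ i = k
  split_ifs
  · fin_cases k <;> norm_num
  · simp

lemma cc_sq_le {d s : ℕ} (σ : Fin d → Fin 3) (i : Fin d) : cc d s σ i ^ 2 ≤ b0 d s i := by
  unfold cc b0
  generalize σ i = k
  split_ifs
  · fin_cases k <;> norm_num
  · simp

lemma HH_le {d s : ℕ} (hd : s ≤ d) (σ : Fin d → Fin 3) : HH d s σ ≤ s := by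
  refine (Finset.sum_le_sum fun i _ => cc_sq_le σ i).trans ?_
  unfold b0
  rw [Finset.sum_boole, Fin.card_filter_val_lt]
  exact_mod_cast (min_le_right _ _)

lemma main_bound (d s : ℕ) (hs : 1 ≤ s) (hd : s ≤ d) :
    ∑ σ ∈ BB d s, Real.exp (Real.log (Real.exp 1 * d / s) / (36 * s) * (∑ i, cc d s σ i) ^ 2)
      ≤ (Real.exp 1 + 1) * ((BB d s).card : ℝ) := by
  have hmgf := mgf_H d s hs hd
  set L := Real.log (Real.exp 1 * d / s) with hL
  have hs0 : (0 : ℝ) < s := by exact_mod_cast hs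
  have hd0 : (0 : ℝ) < d := by exact_mod_cast (lt_of_lt_of_le hs hd)
  have hsd : (s : ℝ) ≤ d := by exact_mod_cast hd
  have hL0 : 0 < L := by
    apply Real.log_pos
    rw [lt_div_iff₀ hs0]
    have := Real.add_one_le_exp (1 : ℝ)
    nlinarith
  set a := L / (36 * s) with ha
  have ha0 : 0 < a := by positivity
  have hLa : L = 36 * s * a := by rw [ha]; field_simp
  let g : (Fin d → Fin 3) → ℝ := fun σ => Real.exp (a * (∑ i, cc d s σ i) ^ 2)
  have inner : ∀ σ, ∑ A : Finset (Fin d), g (flip3 A σ) ≤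
      2 ^ d * (Real.exp 1 + Real.exp (L * HH d s σ) * Real.exp (-(3 * s))) := by
    intro σ
    by_cases hH : 4 * a * HH d s σ ≤ 1
    · have := rad_aux (cc d s σ) Finset.univ a ha0.le hH
      rw [Finset.powerset_univ, Finset.card_univ, Fintype.card_fin] at this
      simp only [g, cc_flip3]
      refine this.trans (mul_le_mul_of_nonneg_left ?_ (by positivity))
      have h1 : Real.exp (2 * a * ∑ i, cc d s σ i ^ 2) ≤ Real.exp 1 := by
        apply Real.exp_le_exp.2
        change 2 * a * HH d s σ ≤ 1
        linarith
      have : 0 ≤ Real.exp (L * HH d s σ) * Real.exp (-(3 * s)) := by positivity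
      linarith
    · push Not at hH
      have hb : ∀ A : Finset (Fin d), g (flip3 A σ) ≤
          Real.exp 1 + Real.exp (L * HH d s σ) * Real.exp (-(3 * s)) := by
        intro A
        have habs : |∑ i, cc d s (flip3 A σ) i| ≤ HH d s σ := by
          refine (Finset.abs_sum_le_sum_abs _ _).trans (le_of_eq ?_)
          unfold HH
          refine Finset.sum_congr rfl fun i _ => ?_
          rw [abs_cc, cc_flip3]
          split_ifs <;> ring
        have hsq : (∑ i, cc d s (flip3 A σ) i) ^ 2 ≤ HH d s σ ^ 2 := by
          rw [← sq_abs]; exact pow_le_pow_left₀ (abs_nonneg _) habs 2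
        have hH0 : 0 ≤ HH d s σ := (abs_nonneg _).trans habs
        have hHs := HH_le hd σ
        have : g (flip3 A σ) ≤ Real.exp (L * HH d s σ) * Real.exp (-(3 * s)) := by
          rw [← Real.exp_add]
          apply Real.exp_le_exp.2
          refine (mul_le_mul_of_nonneg_left hsq ha0.le).trans ?_
          rw [hLa]
          have h1 : a * HH d s σ ^ 2 ≤ s * (a * HH d s σ) := by
            nlinarith [mul_nonneg ha0.le hH0]
          nlinarith [mul_pos hs0 (sub_pos.2 hH)]
        have := Real.exp_pos 1
        linarith
      refine (Finset.sum_le_sum fun A _ => hb A).trans (le_of_eq ?_)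
      simp only [Finset.sum_const, Finset.card_univ, Fintype.card_finset, Fintype.card_fin, nsmul_eq_mul]
      push_cast
      rfl
  have sym : ∀ A : Finset (Fin d), ∑ σ ∈ BB d s, g (flip3 A σ) = ∑ σ ∈ BB d s, g σ := by
    intro A
    refine Finset.sum_nbij' (flip3 A) (flip3 A) (fun σ h => flip3_mem A σ h)
      (fun σ h => flip3_mem A σ h) (fun σ _ => flip3_flip3 A σ) (fun σ _ => flip3_flip3 A σ)
      (fun σ _ => rfl)
  have tot : (2 : ℝ) ^ d * ∑ σ ∈ BB d s, g σ = ∑ σ ∈ BB d s, ∑ A : Finset (Fin d), g (flip3 A σ) := by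
    rw [Finset.sum_comm, Finset.sum_congr rfl fun A _ => sym A]
    simp
  have fin : (2 : ℝ) ^ d * ∑ σ ∈ BB d s, g σ ≤ 2 ^ d * ((Real.exp 1 + 1) * ((BB d s).card : ℝ)) := by
    rw [tot]
    refine (Finset.sum_le_sum fun σ _ => inner σ).trans ?_
    rw [← Finset.mul_sum, Finset.sum_add_distrib, ← Finset.sum_mul]
    refine mul_le_mul_of_nonneg_left ?_ (by positivity)
    have h1 := mul_le_mul_of_nonneg_right hmgf (Real.exp_pos (-(3 * (s : ℝ)))).le
    rw [mul_assoc, ← Real.exp_add] at h1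
    simp only [add_neg_cancel, Real.exp_zero, mul_one] at h1
    simp only [Finset.sum_const, nsmul_eq_mul]
    linarith
  exact le_of_mul_le_mul_left fin (by positivity)


/-- MGF bound for the squared overlap of random sparse sign vectors
(Lemma 1 of Cai–Ma–Wu). Vectors in `{−1,0,1}^d` with exactly `s` nonzero coordinates
are encoded as functions `σ : Fin d → Fin 3` via `β i = (σ i : ℝ) − 1`, so nonzero
coordinates correspond to `σ i ≠ 1`; `β₀` has first `s` coordinates equal to `1`. -/
theorem stmt5 :
    ∃ τ : ℝ → ℝ, Filter.Tendsto τ (nhdsWithin 0 (Set.Ioi 0)) (nhds 1) ∧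
      ∀ (d s : ℕ), 1 ≤ s → s ≤ d → ∀ b : ℝ, b ∈ Set.Ioo (0 : ℝ) (1 / 36) →
        ∀ lam : ℝ, lam = (b / s) * Real.log (Real.exp 1 * d / s) →
        ∀ B : Finset (Fin d → Fin 3),
          B = Finset.univ.filter
            (fun σ => (Finset.univ.filter (fun i => σ i ≠ 1)).card = s) →
        ∀ β₀ : Fin d → ℝ, β₀ = (fun i : Fin d => if (i : ℕ) < s then (1 : ℝ) else 0) →
          (1 / (B.card : ℝ)) *
              ∑ σ ∈ B, Real.exp (lam * (∑ i, (((σ i : ℕ) : ℝ) - 1) * β₀ i) ^ 2)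
            ≤ τ b := by

  refine ⟨fun b => 1 + 36 * b * Real.exp 1, ?_, ?_⟩
  · have : Filter.Tendsto (fun b : ℝ => 1 + 36 * b * Real.exp 1) (nhds 0)
        (nhds (1 + 36 * 0 * Real.exp 1)) := by
      apply Continuous.tendsto (f := fun b : ℝ => 1 + 36 * b * Real.exp 1); fun_prop
    simp only [mul_zero, zero_mul, add_zero] at this
    exact this.mono_left nhdsWithin_le_nhds
  · intro d s hs hd b hb lam hlam B hB β₀ hβ
    have hBB : B = BB d s := hB
    have hβ' : β₀ = b0 d s := hβ
    subst hBB hβ'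
    have hmain := main_bound d s hs hd
    have hs0 : (0 : ℝ) < s := by exact_mod_cast hs
    have hd0 : (0 : ℝ) < d := by exact_mod_cast (lt_of_lt_of_le hs hd)
    have hcard : (0 : ℝ) < ((BB d s).card : ℝ) :=
      lt_of_lt_of_le (by positivity) (card_BB_lower d s hs hd)
    have hpt : ∀ σ ∈ BB d s,
        Real.exp (lam * (∑ i, (((σ i : ℕ) : ℝ) - 1) * b0 d s i) ^ 2) ≤
        (1 - 36 * b) + 36 * b * Real.exp (Real.log (Real.exp 1 * d / s) / (36 * s) *
          (∑ i, cc d s σ i) ^ 2) := by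
      intro σ _
      change Real.exp (lam * (∑ i, cc d s σ i) ^ 2) ≤ _
      have hc := convexOn_exp.2 (Set.mem_univ (0 : ℝ))
        (Set.mem_univ (Real.log (Real.exp 1 * d / s) / (36 * s) * (∑ i, cc d s σ i) ^ 2))
        (show 0 ≤ 1 - 36 * b by linarith [hb.2]) (show 0 ≤ 36 * b by linarith [hb.1]) (by ring)
      simp only [smul_eq_mul, mul_zero, zero_add, Real.exp_zero, mul_one] at hc
      refine le_trans (le_of_eq ?_) hc
      rw [hlam]; congr 1; field_simp
    have hsum := Finset.sum_le_sum hpt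
    rw [Finset.sum_add_distrib, ← Finset.mul_sum] at hsum
    simp only [Finset.sum_const, nsmul_eq_mul] at hsum
    rw [one_div, inv_mul_le_iff₀ hcard]
    have := mul_le_mul_of_nonneg_left hmain (show 0 ≤ 36 * b by linarith [hb.1])
    nlinarith
end

section
/- For every η ∈ (0,1) there exists c > 0 such that the following holds for all ε ∈ (0, 1/3], γ > 0, integers d ≥ 1, 1 ≤ s ≤ d, and n ≥ 1 with n ≤ c · (ε⁴/γ⁴) · s · log(e d / s). Let Θ := { θ ∈ {−1/√s, 0, 1/√s}^d : θ has exactly s nonzero coordinates }, for θ ∈ Θ let q_θ(x) := (1−ε)·φ_{γθ,I}(x) + ε·φ_{−((1−ε)/ε)γθ,I}(x), and let Q(x₁,…,x_n) := (1/|Θ|) ∑_{θ∈Θ} ∏_{i=1}^n q_θ(x_i). Then the total variation distance (1/2)∫_{(ℝ^d)^n} | Q(x₁,…,x_n) − ∏_{i=1}^n φ_{0,I}(x_i) | dx₁⋯dx_n ≤ η. -/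
open MeasureTheory Real

/-- The Gaussian density `φ_{μ,I}` on `ℝ^d` with identity covariance. -/
noncomputable def gaussI {d : ℕ} (μ : Fin d → ℝ) (x : Fin d → ℝ) : ℝ :=
  (2 * π) ^ (-(d : ℝ) / 2) * Real.exp (-(1 / 2) * ∑ i, (x i - μ i) ^ 2)


lemma aux_cosh_le (L u : ℝ) (hL : 1 ≤ L) :
    1 + exp (1 - L) * (cosh u - 1) ≤ exp (2 * u ^ 2 / L) := by
  have hp1 : exp (1 - L) ≤ 1 := by
    rw [Real.exp_le_one_iff]; linarith
  have hp0 := Real.exp_pos (1 - L)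
  have hc1 := Real.one_le_cosh u
  rcases le_total |u| (L / 2) with h | h
  · have key : cosh u - 1 ≤ u ^ 2 / 2 * exp |u| := by
      rw [← Real.cosh_abs u, ← sq_abs u]
      have hw := abs_nonneg u
      generalize |u| = w at *
      · have e1 : cosh w - 1 = 2 * sinh (w / 2) ^ 2 := by
          have := Real.cosh_two_mul (w / 2)
          have h2 := Real.cosh_sq (w / 2)
          rw [mul_div_cancel₀ _ (two_ne_zero)] at this
          rw [this, h2]; ring
        have e2 : sinh (w / 2) ≤ w / 2 * exp (w / 2) := by
          rw [Real.sinh_eq]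
          have h1 : exp (-(w / 2)) = exp (w / 2) * exp (-w) := by
            rw [← Real.exp_add]; ring_nf
          have h2 := Real.add_one_le_exp (-w)
          rw [h1]
          nlinarith [Real.exp_pos (w / 2)]
        have e3 : 0 ≤ sinh (w / 2) := Real.sinh_nonneg_iff.2 (by linarith)
        have e4 : exp w = exp (w / 2) ^ 2 := by
          rw [← Real.exp_nat_mul]; congr 1; push_cast; ring
        rw [e1, e4]
        have := pow_le_pow_left₀ e3 e2 2
        nlinarith
    have h1 : exp (1 - L) * exp |u| ≤ exp (1 - L / 2) := by
      rw [← Real.exp_add]; apply Real.exp_le_exp.2; linarith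
    have h2 : exp (1 - L / 2) ≤ 2 / L := by
      have h3 := Real.add_one_le_exp (L / 2 - 1)
      have h4 : exp (1 - L / 2) * exp (L / 2 - 1) = 1 := by
        rw [← Real.exp_add]; simp
      rw [le_div_iff₀ (by linarith)]
      nlinarith [Real.exp_pos (1 - L / 2)]
    have h5 : exp (1 - L) * (cosh u - 1) ≤ 2 * u ^ 2 / L := by
      calc exp (1 - L) * (cosh u - 1) ≤ exp (1 - L) * (u ^ 2 / 2 * exp |u|) := by gcongr
        _ = u ^ 2 / 2 * (exp (1 - L) * exp |u|) := by ring
        _ ≤ u ^ 2 / 2 * (2 / L) := by gcongr; exact h1.trans h2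
        _ ≤ 2 * u ^ 2 / L := by
          rw [show u ^ 2 / 2 * (2 / L) = u ^ 2 / L by ring]
          gcongr; nlinarith [sq_nonneg u]
    have := Real.add_one_le_exp (exp (1 - L) * (cosh u - 1))
    have h6 := Real.exp_le_exp.2 h5
    linarith
  · have h1 : 1 + exp (1 - L) * (cosh u - 1) ≤ cosh u := by nlinarith
    have h2 : cosh u ≤ exp |u| := by
      rw [← Real.cosh_abs u, Real.cosh_eq]
      have : exp (-|u|) ≤ exp |u| := Real.exp_le_exp.2 (by linarith [abs_nonneg u])
      linarith
    refine h1.trans (h2.trans (Real.exp_le_exp.2 ?_))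
    rw [le_div_iff₀ (by linarith), ← sq_abs u]
    nlinarith [abs_nonneg u]

lemma aux_hoeff (ε t : ℝ) (h0 : 0 < ε) (h1 : ε ≤ 1 / 3) :
    (1 - ε) ^ 2 * exp (1 * 1 * t) + 2 * ((1 - ε) * ε) * exp (-((1 - ε) / ε) * t)
      + ε ^ 2 * exp (((1 - ε) / ε) ^ 2 * t) ≤ exp (t ^ 2 / (2 * ε ^ 4)) := by
  set M := 1 / ε ^ 2 with hM
  have hM0 : 0 < M := by positivity
  have chord : ∀ b : ℝ, |b| ≤ M → exp (b * t) ≤ cosh (M * t) + b / M * sinh (M * t) := by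
    intro b hb
    obtain ⟨hb1, hb2⟩ := abs_le.1 hb
    have hcv := convexOn_exp.2
    have := @hcv (M * t) (Set.mem_univ (M * t)) (-(M * t)) (Set.mem_univ (-(M * t)))
      ((M + b) / (2 * M)) ((M - b) / (2 * M))
      (div_nonneg (by linarith) (by linarith)) (div_nonneg (by linarith) (by linarith))
      (by field_simp; ring)
    simp only [smul_eq_mul] at this
    rw [Real.cosh_eq, Real.sinh_eq]
    have e : (M + b) / (2 * M) * (M * t) + (M - b) / (2 * M) * (-(M * t)) = b * t := by
      field_simp; ring
    rw [e] at this
    refine this.trans (le_of_eq ?_)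
    field_simp; ring
  have hr0 : 0 ≤ (1 - ε) / ε := div_nonneg (by linarith) h0.le
  have hM1 : 1 ≤ M := by
    rw [hM, le_div_iff₀ (by positivity)]; nlinarith
  have hr : (1 - ε) / ε ≤ M := by
    rw [hM, div_le_div_iff₀ h0 (by positivity)]; nlinarith
  have hr2 : ((1 - ε) / ε) ^ 2 ≤ M := by
    rw [hM, div_pow]; gcongr; nlinarith
  have c1 := chord (1 * 1) (by simpa using hM1)
  have c2 := chord (-((1 - ε) / ε)) (by rw [abs_neg, abs_of_nonneg hr0]; exact hr)
  have c3 := chord (((1 - ε) / ε) ^ 2) (by rw [abs_of_nonneg (by positivity)]; exact hr2)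
  have hc := Real.cosh_le_exp_half_sq (M * t)
  have e : (M * t) ^ 2 / 2 = t ^ 2 / (2 * ε ^ 4) := by rw [hM]; field_simp
  rw [e] at hc
  refine le_trans ?_ hc
  have h1' : 0 ≤ 1 - ε := by linarith
  calc _ ≤ (1 - ε) ^ 2 * (cosh (M * t) + (1 * 1) / M * sinh (M * t))
        + 2 * ((1 - ε) * ε) * (cosh (M * t) + -((1 - ε) / ε) / M * sinh (M * t))
      + ε ^ 2 * (cosh (M * t) + ((1 - ε) / ε) ^ 2 / M * sinh (M * t)) := by gcongr
    _ = cosh (M * t) := by field_simp; ring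

lemma aux_choose (k d s : ℕ) (hks : k ≤ s) (hsd : s ≤ d) :
    (d - k).choose (s - k) * d ^ k ≤ s ^ k * d.choose s := by
  induction k with
  | zero => simp
  | succ k ih =>
    have ih := ih (by omega)
    obtain ⟨a, ha⟩ : ∃ a, d = a + 1 + k := ⟨d - k - 1, by omega⟩
    obtain ⟨b, hb⟩ : ∃ b, s = b + 1 + k := ⟨s - k - 1, by omega⟩
    have e1 : d - (k + 1) = a := by omega
    have e2 : s - (k + 1) = b := by omega
    have e3 : d - k = a + 1 := by omega
    have e4 : s - k = b + 1 := by omega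
    rw [e3, e4] at ih
    rw [e1, e2]
    have h := Nat.add_one_mul_choose_eq a b
    -- (a+1) * C(a,b) = C(a+1,b+1) * (b+1)
    have h2 : a.choose b * d ≤ (a+1).choose (b+1) * s := by
      have hab : b ≤ a := by omega
      refine Nat.le_of_mul_le_mul_left ?_ (Nat.succ_pos a)
      have h3 : (b + 1) * d ≤ (a + 1) * s := by
        rw [ha, hb]; nlinarith
      calc (a+1) * (a.choose b * d) = (a+1).choose (b+1) * ((b + 1) * d) := by
            rw [← mul_assoc, h]; ring
        _ ≤ (a+1).choose (b+1) * ((a+1) * s) := Nat.mul_le_mul_left _ h3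
        _ = (a+1) * ((a+1).choose (b+1) * s) := by ring
    calc a.choose b * d ^ (k+1) = a.choose b * d * d ^ k := by ring
      _ ≤ (a+1).choose (b+1) * s * d ^ k := by gcongr
      _ = ((a+1).choose (b+1) * d ^ k) * s := by ring
      _ ≤ (s ^ k * d.choose s) * s := by gcongr
      _ = _ := by ring

open Finset in
lemma aux_count {d : ℕ} (s : ℕ) (K : Finset (Fin d)) (hK : K.card ≤ s) :
    ((powersetCard s (univ : Finset (Fin d))).filter (fun S => K ⊆ S)).card
      = (d - K.card).choose (s - K.card) := by
  have : (d - K.card).choose (s - K.card) = (powersetCard (s - K.card) (univ \ K)).card := by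
    rw [card_powersetCard, card_sdiff_of_subset (subset_univ _)]; simp
  rw [this]
  apply Finset.card_bij' (fun S _ => S \ K) (fun S _ => S ∪ K)
  · intro S hS
    simp only [mem_filter, mem_powersetCard] at hS ⊢
    exact ⟨sdiff_subset_sdiff (subset_univ _) (le_refl _), by
      rw [card_sdiff_of_subset hS.2, hS.1.2]⟩
  · intro S hS
    simp only [mem_filter, mem_powersetCard] at hS ⊢
    have hd : Disjoint S K := by
      rw [Finset.disjoint_left]; intro x hx hk
      have := hS.1 hx
      simp [hk] at this
    refine ⟨⟨subset_univ _, ?_⟩, subset_union_right⟩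
    rw [card_union_of_disjoint hd, hS.2]; omega
  · intro S hS
    simp only [mem_filter, mem_powersetCard] at hS ⊢
    exact sdiff_union_of_subset hS.2
  · intro S hS
    simp only [mem_powersetCard] at hS ⊢
    have hd : Disjoint S K := by
      rw [Finset.disjoint_left]; intro x hx hk
      have := hS.1 hx
      simp [hk] at this
    exact union_sdiff_cancel_right hd

open Finset in
lemma aux_hyper {d : ℕ} (s : ℕ) (hd : 1 ≤ d) (hsd : s ≤ d) (T : Finset (Fin d)) (hT : T.card = s) (z : ℝ)
    (hz : 1 ≤ z) :
    ∑ S ∈ powersetCard s (univ : Finset (Fin d)), ∏ i ∈ S, (if i ∈ T then z else 1)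
      ≤ (d.choose s : ℝ) * (1 + (s / d : ℝ) * (z - 1)) ^ s := by
  have h1 : ∀ S : Finset (Fin d), ∏ i ∈ S, (if i ∈ T then z else 1)
      = ∑ K ∈ T.powerset, if K ⊆ S then (z - 1) ^ K.card else 0 := by
    intro S
    rw [prod_ite]
    simp only [prod_const, one_pow, mul_one]
    have : z ^ (S.filter (· ∈ T)).card = ∑ K ∈ (S.filter (· ∈ T)).powerset, (z-1) ^ K.card := by
      rw [Finset.sum_powerset_apply_card (fun k => (z-1)^k)]
      conv_lhs => rw [show z = (z - 1) + 1 by ring, add_pow]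
      simp [mul_comm]
    rw [this, ← Finset.sum_filter]
    apply sum_congr _ (fun _ _ => rfl)
    ext K
    simp only [mem_powerset, mem_filter, subset_iff]
    constructor
    · intro h; exact ⟨fun x hx => (h hx).2, fun x hx => (h hx).1⟩
    · intro h x hx; exact ⟨h.2 hx, h.1 hx⟩
  simp_rw [h1]
  rw [sum_comm]
  have h2 : ∀ K ∈ T.powerset, (∑ S ∈ powersetCard s (univ : Finset (Fin d)),
      if K ⊆ S then (z - 1) ^ K.card else 0) ≤ (d.choose s : ℝ) * ((s / d : ℝ) * (z - 1)) ^ K.card := by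
    intro K hK
    have hKs : K.card ≤ s := by rw [← hT]; exact card_le_card (mem_powerset.1 hK)
    rw [← Finset.sum_filter, sum_const, aux_count s K hKs, nsmul_eq_mul, mul_pow, ← mul_assoc]
    have := aux_choose K.card d s hKs hsd
    have hz' : (0:ℝ) ≤ (z - 1) ^ K.card := pow_nonneg (by linarith) _
    apply mul_le_mul_of_nonneg_right _ hz'
    rw [div_pow, ← mul_div_assoc, le_div_iff₀ (by positivity), mul_comm (d.choose s : ℝ)]
    exact_mod_cast this
  refine (sum_le_sum h2).trans (le_of_eq ?_)
  rw [← mul_sum, Finset.sum_powerset_apply_card (fun k => ((s / d : ℝ) * (z - 1))^k), hT]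
  conv_rhs => rw [add_comm (1 : ℝ), add_pow]
  simp [mul_comm]

open Finset in
lemma aux_theta {d : ℕ} (s : ℕ) (g : Fin d → Fin 3 → ℝ) :
    ∑ σ ∈ (univ : Finset (Fin d → Fin 3)).filter
          (fun σ => (univ.filter (fun i => σ i ≠ 1)).card = s), ∏ i, g i (σ i)
    = ∑ S ∈ powersetCard s (univ : Finset (Fin d)),
        ∏ i, if i ∈ S then g i 0 + g i 2 else g i 1 := by
  rw [← Finset.sum_fiberwise_of_maps_to (g := fun σ : Fin d → Fin 3 => univ.filter (fun i => σ i ≠ 1))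
    (t := powersetCard s (univ : Finset (Fin d)))]
  · apply sum_congr rfl
    intro S hS
    have hS := (mem_powersetCard.1 hS).2
    have : ∀ i, (if i ∈ S then g i 0 + g i 2 else g i 1)
        = ∑ j ∈ (if i ∈ S then {0, 2} else {1} : Finset (Fin 3)), g i j := by
      intro i; split_ifs <;> simp
    simp_rw [this]
    rw [Finset.prod_univ_sum]
    apply sum_congr _ (fun _ _ => rfl)
    ext σ
    simp only [mem_filter, mem_univ, true_and, Fintype.mem_piFinset]
    have h3 : ∀ j : Fin 3, j ≠ 1 ↔ j ∈ ({0, 2} : Finset (Fin 3)) := by decide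
    constructor
    · rintro ⟨_, rfl⟩ i
      by_cases h : σ i = 1
      · simp [h]
      · rw [if_pos (by simp [h])]; exact (h3 _).1 h
    · intro h
      have : univ.filter (fun i => σ i ≠ 1) = S := by
        ext i
        have := h i
        simp only [mem_filter, mem_univ, true_and]
        split_ifs at this with hi
        · simp only [hi, iff_true]; exact (h3 _).2 this
        · simp only [hi, iff_false, not_not]; simpa using this
      exact ⟨by rw [this, hS], this⟩
  · intro σ hσ
    simpa using hσ

open ProbabilityTheory in
lemma gaussI_eq_prod {d : ℕ} (μ x : Fin d → ℝ) :
    gaussI μ x = ∏ i, gaussianPDFReal (μ i) 1 (x i) := by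
  unfold gaussI gaussianPDFReal
  rw [Finset.prod_mul_distrib, ← Real.exp_sum]
  congr 1
  · simp only [NNReal.coe_one, mul_one, Finset.prod_const, Finset.card_univ, Fintype.card_fin]
    rw [Real.sqrt_eq_rpow, ← Real.rpow_neg (by positivity), ← Real.rpow_natCast, ← Real.rpow_mul (by positivity)]
    congr 1; ring
  · congr 1
    rw [Finset.mul_sum]
    apply Finset.sum_congr rfl; intro i _
    simp; ring

open ProbabilityTheory in
lemma gaussI_integrable {d : ℕ} (μ : Fin d → ℝ) : Integrable (gaussI μ) := by
  have : gaussI μ = fun x => ∏ i, gaussianPDFReal (μ i) 1 (x i) := by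
    ext x; exact gaussI_eq_prod μ x
  rw [this]
  exact Integrable.fintype_prod (fun i => integrable_gaussianPDFReal (μ i) 1)

open ProbabilityTheory in
lemma gaussI_integral {d : ℕ} (μ : Fin d → ℝ) : ∫ x, gaussI μ x = 1 := by
  simp_rw [gaussI_eq_prod]
  rw [integral_fintype_prod_volume_eq_prod (fun i => gaussianPDFReal (μ i) 1)]
  simp [integral_gaussianPDFReal_eq_one]

lemma gaussI_pos {d : ℕ} (μ x : Fin d → ℝ) : 0 < gaussI μ x := by
  unfold gaussI; positivity

lemma gaussI_mul {d : ℕ} (μ ν x : Fin d → ℝ) :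
    gaussI μ x * gaussI ν x = exp (∑ i, μ i * ν i) * gaussI (μ + ν) x * gaussI 0 x := by
  unfold gaussI
  set C : ℝ := (2 * π) ^ (-(d : ℝ) / 2)
  have : rexp (-(1 / 2) * ∑ i, (x i - μ i) ^ 2) * rexp (-(1 / 2) * ∑ i, (x i - ν i) ^ 2)
    = exp (∑ i, μ i * ν i) * rexp (-(1 / 2) * ∑ i, (x i - (μ + ν) i) ^ 2) * rexp (-(1 / 2) * ∑ i, (x i - (0 : Fin d → ℝ) i) ^ 2) := by
    rw [← Real.exp_add, ← Real.exp_add, ← Real.exp_add]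
    congr 1
    simp only [Finset.mul_sum, ← Finset.sum_add_distrib]
    apply Finset.sum_congr rfl; intro i _
    simp; ring
  linear_combination C ^ 2 * this

lemma aux_q {d : ℕ} (ε γ : ℝ) (h0 : 0 < ε) (a b : Fin d → ℝ) (qa qb : (Fin d → ℝ) → ℝ)
    (ha : ∀ x, qa x = (1 - ε) * gaussI (γ • a) x + ε * gaussI ((-((1 - ε) / ε) * γ) • a) x)
    (hb : ∀ x, qb x = (1 - ε) * gaussI (γ • b) x + ε * gaussI ((-((1 - ε) / ε) * γ) • b) x) :
    Integrable (fun x => qa x * qb x / gaussI 0 x) ∧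
    ∫ x, qa x * qb x / gaussI 0 x =
      (1 - ε) ^ 2 * exp (1 * 1 * (γ ^ 2 * ∑ i, a i * b i))
      + 2 * ((1 - ε) * ε) * exp (-((1 - ε) / ε) * (γ ^ 2 * ∑ i, a i * b i))
      + ε ^ 2 * exp (((1 - ε) / ε) ^ 2 * (γ ^ 2 * ∑ i, a i * b i)) := by
  set r := (1 - ε) / ε
  set t := γ ^ 2 * ∑ i, a i * b i with ht
  have hs : ∀ u v : ℝ, ∑ i, (u • a) i * (v • b) i = u * v * ∑ i, a i * b i := by
    intro u v; rw [Finset.mul_sum]; apply Finset.sum_congr rfl; intro i _; simp; ring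
  have hx : (fun x => qa x * qb x / gaussI 0 x) = fun x =>
      (1 - ε) ^ 2 * exp (1 * 1 * t) * gaussI (γ • a + γ • b) x
      + ((1 - ε) * ε) * exp (-r * t) * gaussI (γ • a + (-r * γ) • b) x
      + ((1 - ε) * ε) * exp (-r * t) * gaussI ((-r * γ) • a + γ • b) x
      + ε ^ 2 * exp (r ^ 2 * t) * gaussI ((-r * γ) • a + (-r * γ) • b) x := by
    ext x
    rw [div_eq_iff (gaussI_pos _ _).ne', ha, hb]
    have h1 := gaussI_mul (γ • a) (γ • b) x
    have h2 := gaussI_mul (γ • a) ((-r * γ) • b) x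
    have h3 := gaussI_mul ((-r * γ) • a) (γ • b) x
    have h4 := gaussI_mul ((-r * γ) • a) ((-r * γ) • b) x
    rw [hs] at h1 h2 h3 h4
    rw [show γ * γ * ∑ i, a i * b i = 1 * 1 * t by rw [ht]; ring] at h1
    rw [show γ * (-r * γ) * ∑ i, a i * b i = -r * t by rw [ht]; ring] at h2
    rw [show (-r * γ) * γ * ∑ i, a i * b i = -r * t by rw [ht]; ring] at h3
    rw [show (-r * γ) * (-r * γ) * ∑ i, a i * b i = r ^ 2 * t by rw [ht]; ring] at h4
    linear_combination (1 - ε) ^ 2 * h1 + (1 - ε) * ε * h2 + (1 - ε) * ε * h3 + ε ^ 2 * h4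
  have I1 := (gaussI_integrable (γ • a + γ • b)).const_mul ((1 - ε) ^ 2 * exp (1 * 1 * t))
  have I2 := (gaussI_integrable (γ • a + (-r * γ) • b)).const_mul (((1 - ε) * ε) * exp (-r * t))
  have I3 := (gaussI_integrable ((-r * γ) • a + γ • b)).const_mul (((1 - ε) * ε) * exp (-r * t))
  have I4 := (gaussI_integrable ((-r * γ) • a + (-r * γ) • b)).const_mul (ε ^ 2 * exp (r ^ 2 * t))
  rw [hx]
  refine ⟨((I1.add I2).add I3).add I4, ?_⟩
  refine (integral_add ((I1.add I2).add I3) I4).trans ?_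
  rw [integral_add' (I1.add I2) I3, integral_add' I1 I2]
  simp only [integral_const_mul, gaussI_integral]
  ring

lemma aux_q1 {d : ℕ} (ε γ : ℝ) (a : Fin d → ℝ) (qa : (Fin d → ℝ) → ℝ)
    (ha : ∀ x, qa x = (1 - ε) * gaussI (γ • a) x + ε * gaussI ((-((1 - ε) / ε) * γ) • a) x) :
    Integrable qa ∧ ∫ x, qa x = 1 := by
  have : qa = fun x => (1 - ε) * gaussI (γ • a) x + ε * gaussI ((-((1 - ε) / ε) * γ) • a) x := by
    ext x; exact ha x
  rw [this]
  have I1 := (gaussI_integrable (γ • a)).const_mul (1 - ε)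
  have I2 := (gaussI_integrable ((-((1 - ε) / ε) * γ) • a)).const_mul ε
  refine ⟨I1.add I2, ?_⟩
  rw [integral_add I1 I2]
  simp only [integral_const_mul, gaussI_integral]
  ring

lemma aux_tv {α : Type*} [MeasureSpace α] (P Q : α → ℝ) (η : ℝ) (hη : 0 < η)
    (hP : ∀ x, 0 < P x) (iP : Integrable P) (iQ : Integrable Q)
    (eP : ∫ x, P x = 1) (eQ : ∫ x, Q x = 1) (iQP : Integrable (fun x => Q x * Q x / P x))
    (hle : ∫ x, Q x * Q x / P x ≤ 1 + 4 * η ^ 2) :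
    (1 / 2) * ∫ x, |Q x - P x| ≤ η := by
  have I1 := (iQP.sub (iQ.const_mul 2)).add iP
  have I2 := (I1.const_mul (1 / (4 * η))).add (iP.const_mul η)
  have h : ∫ x, |Q x - P x| ≤ ∫ x, (1 / (4 * η)) * (Q x * Q x / P x - 2 * Q x + P x) + η * P x := by
    apply integral_mono_of_nonneg (Filter.Eventually.of_forall fun x => abs_nonneg _) I2
    refine Filter.Eventually.of_forall fun x => ?_
    have hx := hP x
    have e : Q x * Q x / P x - 2 * Q x + P x = |Q x - P x| ^ 2 / P x := by
      rw [sq_abs]; field_simp; ring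
    show |Q x - P x| ≤ (1 / (4 * η)) * (Q x * Q x / P x - 2 * Q x + P x) + η * P x
    rw [e]
    generalize |Q x - P x| = w
    rw [show 1 / (4 * η) * (w ^ 2 / P x) + η * P x = w + (w - 2 * η * P x) ^ 2 / (4 * η * P x) by
      field_simp; ring]
    have : 0 ≤ (w - 2 * η * P x) ^ 2 / (4 * η * P x) := by positivity
    linarith
  have e : ∫ x, (1 / (4 * η)) * (Q x * Q x / P x - 2 * Q x + P x) + η * P x
      = (1 / (4 * η)) * ((∫ x, Q x * Q x / P x) - 1) + η := by
    have := integral_add (I1.const_mul (1 / (4 * η))) (iP.const_mul η)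
    refine this.trans ?_
    rw [integral_const_mul, integral_const_mul, eP]
    have h2 := integral_add (iQP.sub (iQ.const_mul 2)) iP
    have h3 := integral_sub iQP (iQ.const_mul 2)
    have h4 : ∫ x, ((fun x => Q x * Q x / P x) - (fun x => 2 * Q x) + P) x
       = (∫ x, Q x * Q x / P x) - 1 := by
      refine h2.trans ?_
      rw [eP]
      have : ∫ a, ((fun x => Q x * Q x / P x) - fun x => 2 * Q x) a = (∫ x, Q x * Q x / P x) - 2 := by
        refine h3.trans ?_
        rw [integral_const_mul, eQ]; ring
      rw [this]; ring
    rw [h4]; ring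
  rw [e] at h
  have : (1 / (4 * η)) * ((∫ x, Q x * Q x / P x) - 1) ≤ η := by
    rw [div_mul_eq_mul_div, div_le_iff₀ (by positivity)]; nlinarith
  linarith

open ProbabilityTheory in
lemma aux_lin (w : ℝ) : Integrable (fun x => gaussianPDFReal 0 1 x * exp (w * x)) ∧
    ∫ x, gaussianPDFReal 0 1 x * exp (w * x) = exp (w ^ 2 / 2) := by
  have : (fun x => gaussianPDFReal 0 1 x * exp (w * x)) =
      fun x => exp (w ^ 2 / 2) * gaussianPDFReal w 1 x := by
    ext x
    unfold gaussianPDFReal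
    have : rexp (-(x - 0) ^ 2 / (2 * ((1 : NNReal) : ℝ))) * rexp (w * x)
        = exp (w ^ 2 / 2) * rexp (-(x - w) ^ 2 / (2 * ((1 : NNReal) : ℝ))) := by
      rw [← Real.exp_add, ← Real.exp_add]; congr 1; simp; ring
    rw [mul_assoc, this]; ring
  rw [this]
  refine ⟨(integrable_gaussianPDFReal w 1).const_mul _, ?_⟩
  rw [integral_const_mul, integral_gaussianPDFReal_eq_one _ one_ne_zero, mul_one]

open ProbabilityTheory in
lemma aux_sq (b : ℝ) (hb : b < 1 / 2) : Integrable (fun x => gaussianPDFReal 0 1 x * exp (b * x ^ 2)) ∧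
    ∫ x, gaussianPDFReal 0 1 x * exp (b * x ^ 2) = (√(1 - 2 * b))⁻¹ := by
  have : (fun x => gaussianPDFReal 0 1 x * exp (b * x ^ 2)) =
      fun x => (√(2 * π))⁻¹ * exp (-(1 / 2 - b) * x ^ 2) := by
    ext x
    unfold gaussianPDFReal
    rw [mul_assoc, ← Real.exp_add]
    congr 1
    · simp
    · congr 1; simp; ring
  rw [this]
  refine ⟨(integrable_exp_neg_mul_sq (by linarith)).const_mul _, ?_⟩
  rw [integral_const_mul, integral_gaussian, ← Real.sqrt_inv, ← Real.sqrt_mul (by positivity),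
    ← Real.sqrt_inv]
  congr 1
  have : 1 / 2 - b ≠ 0 := by linarith
  have : 1 - 2 * b ≠ 0 := by linarith
  field_simp

lemma aux_fin3 (u : ℝ) (j : Fin 3) :
    exp (u * (((0 : Fin 3) : ℕ) - 1 : ℝ) * (((j : ℕ) : ℝ) - 1))
      + exp (u * (((2 : Fin 3) : ℕ) - 1 : ℝ) * (((j : ℕ) : ℝ) - 1))
      = 2 * (if j ≠ 1 then cosh u else 1) := by
  fin_cases j <;> simp [Real.cosh_eq] <;> norm_num <;> ring

open Finset in
lemma aux_card {d s : ℕ} (Θ : Finset (Fin d → Fin 3))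
    (hΘ : Θ = Finset.univ.filter
          (fun σ => (Finset.univ.filter (fun i => σ i ≠ 1)).card = s)) :
    (Θ.card : ℝ) = 2 ^ s * d.choose s := by
  have h := aux_theta (d := d) s (fun _ _ => 1)
  rw [← hΘ] at h
  simp only [prod_const_one, sum_const, nsmul_eq_mul, mul_one] at h
  rw [h]
  have : ∀ S ∈ powersetCard s (univ : Finset (Fin d)),
      (∏ i, if i ∈ S then (1 + 1 : ℝ) else 1) = 2 ^ s := by
    intro S hS
    rw [Finset.prod_ite_mem, univ_inter, prod_const, (mem_powersetCard.1 hS).2]; norm_num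
  rw [sum_congr rfl this]
  simp [mul_comm]

open Finset in
lemma aux_expsum {d s : ℕ} (hd : 1 ≤ d) (hs : 1 ≤ s) (hsd : s ≤ d) (Θ : Finset (Fin d → Fin 3))
    (hΘ : Θ = Finset.univ.filter
          (fun σ => (Finset.univ.filter (fun i => σ i ≠ 1)).card = s))
    (τ : Fin d → Fin 3) (hτ : τ ∈ Θ) (u : ℝ) :
    ∑ σ ∈ Θ, exp (u * ∑ i, (((σ i : ℕ) : ℝ) - 1) * (((τ i : ℕ) : ℝ) - 1))
      ≤ Θ.card * exp (2 * s * u ^ 2 / Real.log (Real.exp 1 * d / s)) := by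
  have hdp : (0 : ℝ) < d := by exact_mod_cast hd
  have hsp : (0 : ℝ) < s := by exact_mod_cast hs
  set L := Real.log (Real.exp 1 * d / s) with hL
  have hL2 : exp (1 - L) = s / d := by
    rw [Real.exp_sub, hL, Real.exp_log (by positivity)]
    field_simp
  have hL1 : 1 ≤ L := by
    rw [hL, Real.le_log_iff_exp_le (by positivity), le_div_iff₀ hsp]
    have : (s : ℝ) ≤ d := by exact_mod_cast hsd
    gcongr
  set T := univ.filter (fun i => τ i ≠ 1) with hT
  have hTc : T.card = s := by rw [hΘ] at hτ; exact (mem_filter.1 hτ).2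
  have h1 : ∀ σ : Fin d → Fin 3, exp (u * ∑ i, (((σ i : ℕ) : ℝ) - 1) * (((τ i : ℕ) : ℝ) - 1))
      = ∏ i, (fun (i : Fin d) (j : Fin 3) => exp (u * (((j : ℕ) : ℝ) - 1) * (((τ i : ℕ) : ℝ) - 1))) i (σ i) := by
    intro σ
    rw [← Real.exp_sum, mul_sum]
    congr 1; apply sum_congr rfl; intro i _; ring
  simp_rw [h1]
  rw [aux_card Θ hΘ]
  rw [hΘ]
  refine le_of_eq_of_le (aux_theta s
    (fun (i : Fin d) (j : Fin 3) => exp (u * (((j : ℕ) : ℝ) - 1) * (((τ i : ℕ) : ℝ) - 1)))) ?_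
  have h2 : ∀ S ∈ powersetCard s (univ : Finset (Fin d)),
      (∏ i, if i ∈ S then exp (u * (((0 : Fin 3) : ℕ) - 1 : ℝ) * (((τ i : ℕ) : ℝ) - 1))
      + exp (u * (((2 : Fin 3) : ℕ) - 1 : ℝ) * (((τ i : ℕ) : ℝ) - 1)) else
        exp (u * (((1 : Fin 3) : ℕ) - 1 : ℝ) * (((τ i : ℕ) : ℝ) - 1)))
      = 2 ^ s * ∏ i ∈ S, (if i ∈ T then cosh u else 1) := by
    intro S hS
    have e : ∀ i, exp (u * (((1 : Fin 3) : ℕ) - 1 : ℝ) * (((τ i : ℕ) : ℝ) - 1)) = 1 := by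
      intro i; simp
    simp_rw [e, aux_fin3]
    rw [Finset.prod_ite_mem, univ_inter, prod_mul_distrib, prod_const, (mem_powersetCard.1 hS).2]
    simp [hT]
  rw [sum_congr rfl h2, ← mul_sum, mul_assoc]
  gcongr
  refine (aux_hyper s hd hsd T hTc _ (Real.one_le_cosh u)).trans ?_
  gcongr
  have h3 := aux_cosh_le L u hL1
  rw [hL2] at h3
  have h4 : exp (2 * s * u ^ 2 / L) = exp (2 * u ^ 2 / L) ^ s := by
    rw [← Real.exp_nat_mul]; congr 1; ring
  rw [h4]
  have : 0 ≤ (s / d : ℝ) * (cosh u - 1) := 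
    mul_nonneg (by positivity) (by linarith [Real.one_le_cosh u])
  gcongr

open ProbabilityTheory in
lemma aux_sqsum {d s : ℕ} (hd : 1 ≤ d) (hs : 1 ≤ s) (hsd : s ≤ d) (Θ : Finset (Fin d → Fin 3))
    (hΘ : Θ = Finset.univ.filter
          (fun σ => (Finset.univ.filter (fun i => σ i ≠ 1)).card = s))
    (τ : Fin d → Fin 3) (hτ : τ ∈ Θ) (c : ℝ) (hc : 0 < c) (hc1 : c ≤ 1 / 8) :
    ∑ σ ∈ Θ, exp (c * Real.log (Real.exp 1 * d / s) / (2 * s) *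
        (∑ i, (((σ i : ℕ) : ℝ) - 1) * (((τ i : ℕ) : ℝ) - 1)) ^ 2)
      ≤ Θ.card * (1 + 8 * c) := by
  have hdp : (0 : ℝ) < d := by exact_mod_cast hd
  have hsp : (0 : ℝ) < s := by exact_mod_cast hs
  have hL1 : 1 ≤ Real.log (Real.exp 1 * d / s) := by
    rw [Real.le_log_iff_exp_le (by positivity), le_div_iff₀ hsp]
    have : (s : ℝ) ≤ d := by exact_mod_cast hsd
    gcongr
  have hE := aux_expsum hd hs hsd Θ hΘ τ hτ
  set L := Real.log (Real.exp 1 * d / s) with hL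
  set R : (Fin d → Fin 3) → ℝ := fun σ => ∑ i, (((σ i : ℕ) : ℝ) - 1) * (((τ i : ℕ) : ℝ) - 1) with hR
  set k := √(c * L / s) with hk
  have hk2 : k ^ 2 = c * L / s := Real.sq_sqrt (by positivity)
  have h1 : ∀ σ, exp (c * L / (2 * s) * R σ ^ 2)
      = ∫ x, gaussianPDFReal 0 1 x * exp (k * R σ * x) := by
    intro σ
    rw [(aux_lin (k * R σ)).2, mul_pow, hk2]; congr 1; field_simp
  change ∑ σ ∈ Θ, exp (c * L / (2 * s) * R σ ^ 2) ≤ _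
  simp_rw [h1]
  rw [← integral_finsetSum _ (fun σ _ => (aux_lin (k * R σ)).1)]
  have hsq := aux_sq (2 * c) (by linarith)
  have h2 : ∫ x, ∑ σ ∈ Θ, gaussianPDFReal 0 1 x * exp (k * R σ * x)
      ≤ ∫ x, Θ.card * (gaussianPDFReal 0 1 x * exp (2 * c * x ^ 2)) := by
    apply integral_mono (integrable_finsetSum _ (fun σ _ => (aux_lin (k * R σ)).1)) (hsq.1.const_mul _)
    intro x
    have h3 := hE (k * x)
    have e : 2 * s * (k * x) ^ 2 / L = 2 * c * x ^ 2 := by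
      rw [mul_pow, hk2]; field_simp
    rw [e] at h3
    have h4 := mul_le_mul_of_nonneg_left h3 (gaussianPDFReal_nonneg 0 1 x)
    rw [Finset.mul_sum] at h4
    calc _ = ∑ σ ∈ Θ, gaussianPDFReal 0 1 x * exp (k * x * R σ) := by
          apply Finset.sum_congr rfl; intro σ _; congr 2; ring
      _ ≤ _ := h4
      _ = _ := by ring
  refine h2.trans ?_
  rw [integral_const_mul, hsq.2]
  gcongr
  have hpos : 0 < 1 - 2 * (2 * c) := by linarith
  rw [inv_le_comm₀ (Real.sqrt_pos.2 hpos) (by positivity)]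
  apply Real.le_sqrt_of_sq_le
  rw [inv_pow, inv_le_comm₀ (by positivity) hpos]
  rw [inv_le_iff_one_le_mul₀ hpos]
  have h5 : c ^ 2 ≤ 1 / 64 := by nlinarith
  have h6 := mul_le_mul_of_nonneg_left h5 hc.le
  nlinarith

/-- indistinguishability core of the `Ω(s log(ed/s))` lower bound for robust
sparse Gaussian mean testing: for `n ≤ c (ε⁴/γ⁴) s log(ed/s)`, the total variation distance
between the uniform mixture over `Θ` of `n`-fold products of the contaminated Gaussians and
the `n`-fold standard Gaussian is at most `η`. Vectors of `Θ`, with entries in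
`{−1/√s, 0, 1/√s}` and exactly `s` nonzero coordinates, are encoded by `σ : Fin d → Fin 3`
via `θ σ i = ((σ i : ℝ) − 1)/√s`. -/
theorem stmt7 (η : ℝ) (hη : η ∈ Set.Ioo (0 : ℝ) 1) :
    ∃ c : ℝ, 0 < c ∧
      ∀ (ε : ℝ), ε ∈ Set.Ioc 0 (1 / 3 : ℝ) → ∀ γ : ℝ, 0 < γ →
      ∀ (d s n : ℕ), 1 ≤ d → 1 ≤ s → s ≤ d → 1 ≤ n →
        (n : ℝ) ≤ c * (ε ^ 4 / γ ^ 4) * s * Real.log (Real.exp 1 * d / s) →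
      ∀ Θ : Finset (Fin d → Fin 3),
        Θ = Finset.univ.filter
          (fun σ => (Finset.univ.filter (fun i => σ i ≠ 1)).card = s) →
      ∀ θ : (Fin d → Fin 3) → Fin d → ℝ,
        (∀ σ i, θ σ i = (((σ i : ℕ) : ℝ) - 1) / Real.sqrt s) →
      ∀ q : (Fin d → Fin 3) → (Fin d → ℝ) → ℝ,
        (∀ σ x, q σ x =
          (1 - ε) * gaussI (γ • θ σ) x + ε * gaussI ((-((1 - ε) / ε) * γ) • θ σ) x) →
        (1 / 2) * ∫ x : Fin n → Fin d → ℝ,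
            |(1 / (Θ.card : ℝ)) * (∑ σ ∈ Θ, ∏ i, q σ (x i)) - ∏ i, gaussI 0 (x i)|
          ≤ η := by
  obtain ⟨hη0, hη1⟩ := hη
  refine ⟨η ^ 2 / 8, by positivity, ?_⟩
  set c := η ^ 2 / 8 with hc
  have hc0 : 0 < c := by positivity
  have hc1 : c ≤ 1 / 8 := by rw [hc]; nlinarith
  intro ε hε γ hγ d s n hd hs hsd hn hle Θ hΘ θ hθ q hq
  obtain ⟨hε0, hε1⟩ := hε
  have hsp : (0 : ℝ) < s := by exact_mod_cast hs
  have hN : (Θ.card : ℝ) = 2 ^ s * d.choose s := aux_card Θ hΘ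
  have hNpos : (0 : ℝ) < Θ.card := by
    rw [hN]; have := Nat.choose_pos hsd; positivity
  have i1 : ∀ σ, Integrable (fun x : Fin n → Fin d → ℝ => ∏ i, q σ (x i)) := fun σ =>
    Integrable.fintype_prod (fun _ => (aux_q1 ε γ (θ σ) (q σ) (hq σ)).1)
  have e1 : ∀ σ, ∫ x : Fin n → Fin d → ℝ, ∏ i, q σ (x i) = 1 := by
    intro σ
    rw [integral_fintype_prod_volume_eq_prod (fun _ => q σ)]
    simp [(aux_q1 ε γ (θ σ) (q σ) (hq σ)).2]
  have i2 : ∀ σ τ, Integrable (fun x : Fin n → Fin d → ℝ => ∏ i, (q σ (x i) * q τ (x i) / gaussI 0 (x i))) :=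
    fun σ τ => Integrable.fintype_prod
      (fun _ => (aux_q ε γ hε0 (θ σ) (θ τ) (q σ) (q τ) (hq σ) (hq τ)).1)
  have e2 : ∀ σ τ, ∫ x : Fin n → Fin d → ℝ, ∏ i, (q σ (x i) * q τ (x i) / gaussI 0 (x i))
      ≤ exp (c * Real.log (Real.exp 1 * d / s) / (2 * s) *
        (∑ i, (((σ i : ℕ) : ℝ) - 1) * (((τ i : ℕ) : ℝ) - 1)) ^ 2) := by
    intro σ τ
    rw [integral_fintype_prod_volume_eq_prod (fun (_ : Fin n) y => q σ y * q τ y / gaussI 0 y)]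
    rw [(aux_q ε γ hε0 (θ σ) (θ τ) (q σ) (q τ) (hq σ) (hq τ)).2]
    rw [Finset.prod_const, Finset.card_univ, Fintype.card_fin]
    set R := ∑ i, (((σ i : ℕ) : ℝ) - 1) * (((τ i : ℕ) : ℝ) - 1) with hR
    have hρ : ∑ i, θ σ i * θ τ i = R / s := by
      rw [hR, Finset.sum_div]
      apply Finset.sum_congr rfl; intro i _
      rw [hθ, hθ, div_mul_div_comm, Real.mul_self_sqrt hsp.le]
    rw [hρ]
    have hh := aux_hoeff ε (γ ^ 2 * (R / s)) hε0 hε1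
    have h1' : 0 ≤ 1 - ε := by linarith
    refine (pow_le_pow_left₀ (by positivity) hh n).trans ?_
    rw [← Real.exp_nat_mul]
    apply Real.exp_le_exp.2
    calc (n : ℝ) * ((γ ^ 2 * (R / s)) ^ 2 / (2 * ε ^ 4))
        ≤ (c * (ε ^ 4 / γ ^ 4) * s * Real.log (Real.exp 1 * d / s)) * ((γ ^ 2 * (R / s)) ^ 2 / (2 * ε ^ 4)) := by
          gcongr
      _ = _ := by field_simp
  have hP : ∀ x : Fin n → Fin d → ℝ, 0 < ∏ i, gaussI 0 (x i) := fun x =>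
    Finset.prod_pos fun i _ => gaussI_pos _ _
  have hexp : (fun x : Fin n → Fin d → ℝ => ((1 / (Θ.card : ℝ)) * (∑ σ ∈ Θ, ∏ i, q σ (x i))) *
      ((1 / (Θ.card : ℝ)) * (∑ σ ∈ Θ, ∏ i, q σ (x i))) / ∏ i, gaussI 0 (x i))
      = fun x => (1 / (Θ.card : ℝ)) ^ 2 * ∑ τ ∈ Θ, ∑ σ ∈ Θ,
          ∏ i, (q σ (x i) * q τ (x i) / gaussI 0 (x i)) := by
    ext x
    simp_rw [Finset.prod_div_distrib, Finset.prod_mul_distrib, ← Finset.sum_div]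
    simp_rw [← Finset.sum_mul, ← Finset.mul_sum]
    ring
  have i3 : ∀ τ ∈ Θ, Integrable (fun x : Fin n → Fin d → ℝ => ∑ σ ∈ Θ,
          ∏ i, (q σ (x i) * q τ (x i) / gaussI 0 (x i))) := fun τ _ =>
    integrable_finsetSum _ fun σ _ => i2 σ τ
  refine aux_tv (fun x : Fin n → Fin d → ℝ => ∏ i, gaussI 0 (x i))
    (fun x => (1 / (Θ.card : ℝ)) * (∑ σ ∈ Θ, ∏ i, q σ (x i))) η hη0 hP ?_ ?_ ?_ ?_ ?_ ?_
  · exact Integrable.fintype_prod (fun _ => gaussI_integrable 0)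
  · exact (integrable_finsetSum _ fun σ _ => i1 σ).const_mul _
  · rw [integral_fintype_prod_volume_eq_prod (fun _ => gaussI 0)]
    simp [gaussI_integral]
  · rw [integral_const_mul, integral_finsetSum _ fun σ _ => i1 σ]
    simp_rw [e1]
    simp only [Finset.sum_const, nsmul_eq_mul, mul_one]
    field_simp
  · rw [hexp]
    exact (integrable_finsetSum _ i3).const_mul _
  · rw [hexp, integral_const_mul, integral_finsetSum _ i3]
    have h1 : ∀ τ ∈ Θ, ∫ x : Fin n → Fin d → ℝ, ∑ σ ∈ Θ,
          ∏ i, (q σ (x i) * q τ (x i) / gaussI 0 (x i)) ≤ Θ.card * (1 + 8 * c) := by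
      intro τ hτ
      rw [integral_finsetSum _ fun σ _ => i2 σ τ]
      exact (Finset.sum_le_sum fun σ _ => e2 σ τ).trans (aux_sqsum hd hs hsd Θ hΘ τ hτ c hc0 hc1)
    have h2 := Finset.sum_le_sum h1
    rw [Finset.sum_const, nsmul_eq_mul] at h2
    calc _ ≤ (1 / (Θ.card : ℝ)) ^ 2 * (Θ.card * (Θ.card * (1 + 8 * c))) := by gcongr
      _ = 1 + 8 * c := by field_simp
      _ ≤ 1 + 4 * η ^ 2 := by rw [hc]; nlinarith [sq_nonneg η]
end
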